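/- Let m = 4, suppose N₀ ≠ N₂, and suppose every g ∈ N₂ \ N₀ acts on ZMod 4 by j ↦ j + 2 (so N₂/N₀ ≅ ℤ₂ acts freely); fix a₀ ∈ N₂ \ N₀. Let j, j', j'' ∈ ZMod 4 with j' = j + 2 and j'' ∉ {j, j'}, and let k ∈ {1, 2, 3} represent j'' − j'. Then the map 𝒜 → P × Q, ψ ↦ (Ψ_j², Ψ_{j'}^k), is a bijection, where P := {B : W j ≃ W j' ℂ-linear equivalence | B is N₀-equivariant and ρ(a₀) ∘ B ∘ ρ(a₀)⁻¹ = B⁻¹ as maps W j' → W j} and Q := {B : W j' ≃ W j'' ℂ-linear equivalence | B is N₀-equivariant}. -/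

import Mathlib

noncomputable section

namespace EqClutch

variable {m : ℕ}

/-- The iterate `Ψ_j^k = ψ_{j+k-1} ∘ ⋯ ∘ ψ_{j+1} ∘ ψ_j : W j ≃ W (j+k)` of a pointwise
preclutching map `ψ`. -/
def Psi {V : Type*} [AddCommGroup V] [Module ℂ V] (W : ZMod m → Submodule ℂ V)
    (ψ : ∀ j : ZMod m, W j ≃ₗ[ℂ] W (j + 1)) :
    ∀ (j : ZMod m) (k : ℕ), W j ≃ₗ[ℂ] W (j + (k : ZMod m))
  | j, 0 => LinearEquiv.ofEq _ _ (by norm_num)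
  | j, (k + 1) =>
      ((Psi W ψ j k).trans (ψ (j + (k : ZMod m)))).trans
        (LinearEquiv.ofEq _ _ (by rw [Nat.cast_add, Nat.cast_one, add_assoc]))

/-- `g` lies in the kernel `N₀` of the action of `N₂` on `ZMod m`. -/
def InKernel (N₂ : Type*) [Group N₂] [MulAction N₂ (ZMod m)] (g : N₂) : Prop :=
  ∀ j : ZMod m, g • j = j

/-- `B : p ≃ q` commutes with `ρ g` (equivariance, stated via the ambient space `V`). -/
def IsEquivariantOn {N₂ : Type*} [Group N₂] {V : Type*} [AddCommGroup V] [Module ℂ V]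
    (ρ : N₂ →* (V ≃ₗ[ℂ] V)) {p q : Submodule ℂ V} (B : p ≃ₗ[ℂ] q) (g : N₂) : Prop :=
  ∀ (w w' : p), (w' : V) = ρ g (w : V) → ((B w' : V) = ρ g ((B w : V)))

/-- A pointwise preclutching map `ψ` is an *equivariant pointwise clutching map*:
(1) `Ψ_j^m = id` for every `j`; (2) for every `j₁` and `g ∈ N₂`, with `j₂ = g⁻¹ • j₁`,
`j₃ = g • (j₂ + 1)` and `k ∈ {0, …, m-1}` the representative of `j₃ - j₁`, one has
`Ψ_{j₁}^k = ρ(g) ∘ ψ_{j₂} ∘ ρ(g)⁻¹` as maps `W j₁ → W j₃`. -/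
def IsClutch {N₂ : Type*} [Group N₂] [MulAction N₂ (ZMod m)]
    {V : Type*} [AddCommGroup V] [Module ℂ V]
    (ρ : N₂ →* (V ≃ₗ[ℂ] V)) (W : ZMod m → Submodule ℂ V)
    (ψ : ∀ j : ZMod m, W j ≃ₗ[ℂ] W (j + 1)) : Prop :=
  (∀ (j : ZMod m) (w : W j), ((Psi W ψ j m) w : V) = (w : V)) ∧
  (∀ (j₁ : ZMod m) (g : N₂) (w₁ : W j₁) (w₂ : W (g⁻¹ • j₁)),
      (w₂ : V) = ρ g⁻¹ (w₁ : V) →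
      ((Psi W ψ j₁ ((g • (g⁻¹ • j₁ + 1) - j₁).val)) w₁ : V) =
        ρ g (((ψ (g⁻¹ • j₁)) w₂ : V)))


section Ambient

variable {V : Type*} [AddCommGroup V] [Module ℂ V]

open Classical in
/-- The extension by zero of `e : p ≃ q` to a self-map of the ambient space. -/
def amb {p q : Submodule ℂ V} (e : p ≃ₗ[ℂ] q) (v : V) : V :=
  if h : v ∈ p then (e ⟨v, h⟩ : V) else 0

theorem amb_coe {p q : Submodule ℂ V} (e : p ≃ₗ[ℂ] q) (w : p) : amb e (w : V) = e w := by
  simp [amb]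

theorem amb_mem {p q : Submodule ℂ V} (e : p ≃ₗ[ℂ] q) {v : V} (hv : v ∈ p) : amb e v ∈ q := by
  simp [amb, hv]

theorem amb_symm_amb {p q : Submodule ℂ V} (e : p ≃ₗ[ℂ] q) {v : V} (hv : v ∈ p) :
    amb e.symm (amb e v) = v := by
  lift v to p using hv
  simp [amb_coe]

theorem amb_amb_symm {p q : Submodule ℂ V} (e : p ≃ₗ[ℂ] q) {v : V} (hv : v ∈ q) :
    amb e (amb e.symm v) = v :=
  amb_symm_amb e.symm hv

theorem amb_index {W : ZMod m → Submodule ℂ V} (ψ : ∀ j : ZMod m, W j ≃ₗ[ℂ] W (j + 1))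
    {i i' : ZMod m} (h : i = i') (v : V) : amb (ψ i) v = amb (ψ i') v := by
  rw [h]

theorem exists_amb_eq {p q : Submodule ℂ V} (e : p ≃ₗ[ℂ] q) {v : V} (hv : v ∈ q) :
    ∃ u ∈ p, amb e u = v :=
  ⟨_, amb_mem e.symm hv, amb_amb_symm e hv⟩

theorem amb_trans {p q r : Submodule ℂ V} (e : p ≃ₗ[ℂ] q) (f : q ≃ₗ[ℂ] r) {v : V}
    (hv : v ∈ p) : amb (e.trans f) v = amb f (amb e v) := by
  lift v to p using hv
  simp [amb_coe]

theorem amb_symm_commute {p q : Submodule ℂ V} (e : p ≃ₗ[ℂ] q) {T : V → V}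
    (hT : ∀ v ∈ p, T v ∈ p) (h : ∀ v ∈ p, amb e (T v) = T (amb e v)) {v : V} (hv : v ∈ q) :
    amb e.symm (T v) = T (amb e.symm v) := by
  have hu := amb_mem e.symm hv
  rw [← amb_symm_amb e (hT _ hu), h _ hu, amb_amb_symm e hv]

theorem amb_injOn {p q : Submodule ℂ V} (e : p ≃ₗ[ℂ] q) {u v : V} (hu : u ∈ p) (hv : v ∈ p)
    (h : amb e u = amb e v) : u = v := by
  rw [← amb_symm_amb e hu, h, amb_symm_amb e hv]

theorem isEquivariantOn_iff {N₂ : Type*} [Group N₂] (ρ : N₂ →* (V ≃ₗ[ℂ] V))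
    {p q : Submodule ℂ V} (B : p ≃ₗ[ℂ] q) {g : N₂} (hg : ∀ v ∈ p, ρ g v ∈ p) :
    IsEquivariantOn ρ B g ↔ ∀ v ∈ p, amb B (ρ g v) = ρ g (amb B v) := by
  constructor
  · intro h v hv
    have := h ⟨v, hv⟩ ⟨ρ g v, hg v hv⟩ rfl
    rwa [← amb_coe, ← amb_coe] at this
  · intro h w w' hw
    rw [← amb_coe, ← amb_coe, hw, h _ w.2]

theorem coe_Psi_zero (W : ZMod m → Submodule ℂ V)
    (ψ : ∀ j : ZMod m, W j ≃ₗ[ℂ] W (j + 1)) (j : ZMod m) (w : W j) :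
    (Psi W ψ j 0 w : V) = w := by
  simp [Psi]

theorem coe_Psi_succ (W : ZMod m → Submodule ℂ V)
    (ψ : ∀ j : ZMod m, W j ≃ₗ[ℂ] W (j + 1)) (j : ZMod m) (k : ℕ) (w : W j) :
    (Psi W ψ j (k + 1) w : V) = amb (ψ (j + (k : ZMod m))) (Psi W ψ j k w : V) := by
  simp [Psi, amb_coe]

theorem coe_Psi_one (W : ZMod m → Submodule ℂ V)
    (ψ : ∀ j : ZMod m, W j ≃ₗ[ℂ] W (j + 1)) (j : ZMod m) (w : W j) :
    (Psi W ψ j 1 w : V) = amb (ψ j) w := by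
  rw [coe_Psi_succ, coe_Psi_zero, Nat.cast_zero, add_zero]

theorem coe_Psi_two (W : ZMod m → Submodule ℂ V)
    (ψ : ∀ j : ZMod m, W j ≃ₗ[ℂ] W (j + 1)) (j : ZMod m) (w : W j) :
    (Psi W ψ j 2 w : V) = amb (ψ (j + 1)) (amb (ψ j) w) := by
  rw [coe_Psi_succ, coe_Psi_one, Nat.cast_one]

theorem coe_Psi_three (W : ZMod m → Submodule ℂ V)
    (ψ : ∀ j : ZMod m, W j ≃ₗ[ℂ] W (j + 1)) (j : ZMod m) (w : W j) :
    (Psi W ψ j 3 w : V) = amb (ψ (j + 2)) (amb (ψ (j + 1)) (amb (ψ j) w)) := by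
  rw [coe_Psi_succ, coe_Psi_two, Nat.cast_two]

theorem coe_Psi_four (W : ZMod m → Submodule ℂ V)
    (ψ : ∀ j : ZMod m, W j ≃ₗ[ℂ] W (j + 1)) (j : ZMod m) (w : W j) :
    (Psi W ψ j 4 w : V) =
      amb (ψ (j + 3)) (amb (ψ (j + 2)) (amb (ψ (j + 1)) (amb (ψ j) w))) := by
  rw [coe_Psi_succ, coe_Psi_three, Nat.cast_three]

theorem amb_Psi_one (W : ZMod m → Submodule ℂ V)
    (ψ : ∀ j : ZMod m, W j ≃ₗ[ℂ] W (j + 1)) {j : ZMod m} {v : V} (hv : v ∈ W j) :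
    amb (Psi W ψ j 1) v = amb (ψ j) v :=
  (amb_coe _ ⟨v, hv⟩).trans (coe_Psi_one W ψ j ⟨v, hv⟩)

theorem amb_Psi_two (W : ZMod m → Submodule ℂ V)
    (ψ : ∀ j : ZMod m, W j ≃ₗ[ℂ] W (j + 1)) {j : ZMod m} {v : V} (hv : v ∈ W j) :
    amb (Psi W ψ j 2) v = amb (ψ (j + 1)) (amb (ψ j) v) :=
  (amb_coe _ ⟨v, hv⟩).trans (coe_Psi_two W ψ j ⟨v, hv⟩)

theorem amb_Psi_three (W : ZMod m → Submodule ℂ V)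
    (ψ : ∀ j : ZMod m, W j ≃ₗ[ℂ] W (j + 1)) {j : ZMod m} {v : V} (hv : v ∈ W j) :
    amb (Psi W ψ j 3) v = amb (ψ (j + 2)) (amb (ψ (j + 1)) (amb (ψ j) v)) :=
  (amb_coe _ ⟨v, hv⟩).trans (coe_Psi_three W ψ j ⟨v, hv⟩)

end Ambient

section Action

variable {N₂ : Type*} [Group N₂] [MulAction N₂ (ZMod 4)]

theorem smul_add_one
    (hfree : ∀ g : N₂, ¬ InKernel (m := 4) N₂ g → ∀ j : ZMod 4, g • j = j + 2)
    (g : N₂) (i : ZMod 4) : g • (i + 1) = g • i + 1 := by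
  by_cases hg : InKernel (m := 4) N₂ g
  · rw [hg, hg]
  · rw [hfree g hg, hfree g hg, add_right_comm]

variable {V : Type*} [AddCommGroup V] [Module ℂ V]

theorem isClutch_iff (ρ : N₂ →* (V ≃ₗ[ℂ] V)) {W : ZMod 4 → Submodule ℂ V}
    (hmem : ∀ (g : N₂) (i : ZMod 4), ∀ v ∈ W i, ρ g v ∈ W (g • i))
    (hfree : ∀ g : N₂, ¬ InKernel (m := 4) N₂ g → ∀ j : ZMod 4, g • j = j + 2)
    (ψ : ∀ j : ZMod 4, W j ≃ₗ[ℂ] W (j + 1)) :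
    IsClutch ρ W ψ ↔
      (∀ i, ∀ v ∈ W i,
        amb (ψ (i + 3)) (amb (ψ (i + 2)) (amb (ψ (i + 1)) (amb (ψ i) v))) = v) ∧
      (∀ (g : N₂) (i : ZMod 4), ∀ v ∈ W i,
        amb (ψ (g • i)) (ρ g v) = ρ g (amb (ψ i) v)) := by
  have hk : ∀ (g : N₂) (i : ZMod 4), (g • (g⁻¹ • i + 1) - i).val = 1 := by
    intro g i
    rw [smul_add_one hfree, smul_inv_smul, add_sub_cancel_left]
    rfl
  refine and_congr ?_ ?_
  · constructor
    · intro h i v hv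
      rw [← coe_Psi_four W ψ i ⟨v, hv⟩, h]
    · intro h i w
      rw [coe_Psi_four, h i w w.2]
  · constructor
    · intro h g i v hv
      have := h (g • i) g ⟨ρ g v, hmem g i v hv⟩ ⟨v, by rwa [inv_smul_smul]⟩ (by simp)
      rw [hk, coe_Psi_one, ← amb_coe] at this
      exact this.trans (congrArg _ (amb_index ψ (inv_smul_smul g i) v))
    · intro h i g w₁ w₂ hw
      have h' := h g (g⁻¹ • i) w₂ w₂.2
      rw [smul_inv_smul] at h'
      rw [hk, coe_Psi_one, ← amb_coe, ← h', hw]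
      simp

theorem map_mem (ρ : N₂ →* (V ≃ₗ[ℂ] V)) {W : ZMod 4 → Submodule ℂ V}
    (hWρ : ∀ (g : N₂) (j : ZMod 4), (W j).map (ρ g).toLinearMap = W (g • j))
    (g : N₂) (i : ZMod 4) (v : V) (hv : v ∈ W i) : ρ g v ∈ W (g • i) := by
  rw [← hWρ]
  exact Submodule.mem_map_of_mem hv

theorem exists_amb_eq_conj (ρ : N₂ →* (V ≃ₗ[ℂ] V)) {W : ZMod 4 → Submodule ℂ V}
    (hWρ : ∀ (g : N₂) (j : ZMod 4), (W j).map (ρ g).toLinearMap = W (g • j))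
    (g : N₂) {i i' k k' : ZMod 4} (hi : g • i = i') (hk : g • k = k') (e : W i ≃ₗ[ℂ] W k) :
    ∃ e' : W i' ≃ₗ[ℂ] W k', ∀ v ∈ W i', amb e' v = ρ g (amb e (ρ g⁻¹ v)) := by
  subst hi hk
  refine ⟨(((ρ g).ofSubmodules _ _ (hWρ g i)).symm.trans e).trans
    ((ρ g).ofSubmodules _ _ (hWρ g k)), fun v hv => ?_⟩
  lift v to W (g • i) using hv
  have h : ρ g⁻¹ (v : V) = (((ρ g).ofSubmodules _ _ (hWρ g i)).symm v : W i) := by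
    simp [LinearEquiv.ofSubmodules_symm_apply]
  rw [h, amb_coe, amb_coe]
  rfl

theorem exists_amb_eq_of_eq {p q p' q' : Submodule ℂ V} (hp : p = p') (hq : q = q')
    (e : p ≃ₗ[ℂ] q) : ∃ e' : p' ≃ₗ[ℂ] q', ∀ v ∈ p', amb e' v = amb e v := by
  subst hp hq
  exact ⟨e, fun _ _ => rfl⟩

/-- Two consecutive equivariant isomorphisms extend to a clutching map, by conjugation with an
element acting as the shift by two. -/
theorem exists_isClutch (ρ : N₂ →* (V ≃ₗ[ℂ] V)) {W : ZMod 4 → Submodule ℂ V}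
    (hWρ : ∀ (g : N₂) (j : ZMod 4), (W j).map (ρ g).toLinearMap = W (g • j))
    (hfree : ∀ g : N₂, ¬ InKernel (m := 4) N₂ g → ∀ j : ZMod 4, g • j = j + 2)
    {a : N₂} (ha : ¬ InKernel (m := 4) N₂ a) (j : ZMod 4)
    (p : W j ≃ₗ[ℂ] W (j + 1)) (q : W (j + 1) ≃ₗ[ℂ] W (j + 2))
    (hp : ∀ g, InKernel (m := 4) N₂ g → ∀ v ∈ W j, amb p (ρ g v) = ρ g (amb p v))
    (hq : ∀ g, InKernel (m := 4) N₂ g → ∀ v ∈ W (j + 1), amb q (ρ g v) = ρ g (amb q v))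
    (hpq : ∀ v ∈ W j, ρ a (amb q (amb p (ρ a⁻¹ (amb q (amb p v))))) = v) :
    ∃ ψ : ∀ i : ZMod 4, W i ≃ₗ[ℂ] W (i + 1), IsClutch ρ W ψ ∧
      (∀ v ∈ W j, amb (ψ j) v = amb p v) ∧
      (∀ v ∈ W (j + 1), amb (ψ (j + 1)) v = amb q v) := by
  have hmem := map_mem ρ hWρ
  have mul_app : ∀ (g h : N₂) (v : V), ρ g (ρ h v) = ρ (g * h) v := by
    intro g h v; rw [map_mul]; rfl
  have one_app : ∀ v : V, ρ 1 v = v := by intro v; rw [map_one]; rfl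
  have cases4 : ∀ i : ZMod 4, i = j ∨ i = j + 1 ∨ i = j + 2 ∨ i = j + 3 := by
    clear * -; revert j; decide
  have h12 : j + 1 + 1 = j + 2 := by clear * -; revert j; decide
  have h13 : j + 1 + 2 = j + 3 := by clear * -; revert j; decide
  have h22 : j + 2 + 2 = j := by clear * -; revert j; decide
  have h32 : j + 3 + 2 = j + 1 := by clear * -; revert j; decide
  have hinv : ∀ i : ZMod 4, a⁻¹ • i = i + 2 := by
    intro i
    rw [inv_smul_eq_iff, hfree a ha]
    clear * -; revert i; decide
  obtain ⟨r, hr⟩ := exists_amb_eq_conj ρ hWρ a (hfree a ha j) (hfree a ha (j + 1)) p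
  obtain ⟨s, hs⟩ := exists_amb_eq_conj ρ hWρ a (hfree a ha (j + 1)) (hfree a ha (j + 2)) q
  have hψ : ∀ i : ZMod 4, ∃ e : W i ≃ₗ[ℂ] W (i + 1),
      (i = j → ∀ v ∈ W i, amb e v = amb p v) ∧
      (i = j + 1 → ∀ v ∈ W i, amb e v = amb q v) ∧
      (i = j + 2 → ∀ v ∈ W i, amb e v = ρ a (amb p (ρ a⁻¹ v))) ∧
      (i = j + 3 → ∀ v ∈ W i, amb e v = ρ a (amb q (ρ a⁻¹ v))) := by
    intro i
    rcases cases4 i with h | h | h | h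
    · obtain ⟨e, he⟩ := exists_amb_eq_of_eq (p' := W i) (q' := W (i + 1)) (by rw [h])
        (by rw [h]) p
      refine ⟨e, fun _ => he, fun h' => ?_, fun h' => ?_, fun h' => ?_⟩ <;>
        exact absurd (h.symm.trans h') (by clear * -; revert j; decide)
    · obtain ⟨e, he⟩ := exists_amb_eq_of_eq (p' := W i) (q' := W (i + 1)) (by rw [h])
        (by rw [h, h12]) q
      refine ⟨e, fun h' => ?_, fun _ => he, fun h' => ?_, fun h' => ?_⟩ <;>
        exact absurd (h.symm.trans h') (by clear * -; revert j; decide)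
    · obtain ⟨e, he⟩ := exists_amb_eq_of_eq (p' := W i) (q' := W (i + 1)) (by rw [h])
        (by rw [h, add_right_comm]) r
      refine ⟨e, fun h' => ?_, fun h' => ?_, fun _ v hv => ?_, fun h' => ?_⟩
      · exact absurd (h.symm.trans h') (by clear * -; revert j; decide)
      · exact absurd (h.symm.trans h') (by clear * -; revert j; decide)
      · rw [he v hv, hr v (h ▸ hv)]
      · exact absurd (h.symm.trans h') (by clear * -; revert j; decide)
    · obtain ⟨e, he⟩ := exists_amb_eq_of_eq (p' := W i) (q' := W (i + 1)) (by rw [h, h13])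
        (by rw [h]; congr 1; clear * -; revert j; decide) s
      refine ⟨e, fun h' => ?_, fun h' => ?_, fun h' => ?_, fun _ v hv => ?_⟩
      · exact absurd (h.symm.trans h') (by clear * -; revert j; decide)
      · exact absurd (h.symm.trans h') (by clear * -; revert j; decide)
      · exact absurd (h.symm.trans h') (by clear * -; revert j; decide)
      · rw [he v hv, hs v (by rw [h13, ← h]; exact hv)]
  choose ψ hψ using hψ
  have hψ0 := (hψ j).1 rfl
  have hψ1 := (hψ (j + 1)).2.1 rfl
  have hψ2 := (hψ (j + 2)).2.2.1 rfl
  have hψ3 := (hψ (j + 3)).2.2.2 rfl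
  clear hψ
  have memA : ∀ i, ∀ v ∈ W i, ρ a v ∈ W (i + 2) := fun i v hv => hfree a ha i ▸ hmem a i v hv
  have memA' : ∀ i, ∀ v ∈ W i, ρ a⁻¹ v ∈ W (i + 2) := fun i v hv => hinv i ▸ hmem a⁻¹ i v hv
  have memA2 : ∀ v ∈ W (j + 2), ρ a⁻¹ v ∈ W j := fun v hv => h22 ▸ memA' _ v hv
  have memA3 : ∀ v ∈ W (j + 3), ρ a⁻¹ v ∈ W (j + 1) := fun v hv => h32 ▸ memA' _ v hv
  have memK : ∀ g, InKernel (m := 4) N₂ g → ∀ i, ∀ v ∈ W i, ρ g v ∈ W i := by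
    intro g hg i v hv
    have := hmem g i v hv
    rwa [hg] at this
  have conjK : ∀ g, InKernel (m := 4) N₂ g → InKernel (m := 4) N₂ (a⁻¹ * g * a) := by
    intro g hg i
    rw [mul_smul, mul_smul, hg, inv_smul_smul]
  have sqK : InKernel (m := 4) N₂ (a * a) := by
    intro i
    rw [mul_smul, hfree a ha, hfree a ha]
    clear * -; revert i; decide
  have eqK : ∀ g, InKernel (m := 4) N₂ g → ∀ i, ∀ v ∈ W i,
      amb (ψ i) (ρ g v) = ρ g (amb (ψ i) v) := by
    intro g hg i v hv
    have key : ρ a⁻¹ (ρ g v) = ρ (a⁻¹ * g * a) (ρ a⁻¹ v) := by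
      simp only [mul_app]; congr 2; group
    rcases cases4 i with rfl | rfl | rfl | rfl
    · rw [hψ0 _ hv, hψ0 _ (memK g hg _ _ hv), hp g hg v hv]
    · rw [hψ1 _ hv, hψ1 _ (memK g hg _ _ hv), hq g hg v hv]
    · rw [hψ2 _ hv, hψ2 _ (memK g hg _ _ hv), key, hp _ (conjK g hg) _ (memA2 v hv)]
      simp only [mul_app]; congr 2; group
    · rw [hψ3 _ hv, hψ3 _ (memK g hg _ _ hv), key, hq _ (conjK g hg) _ (memA3 v hv)]
      simp only [mul_app]; congr 2; group
  have eqA : ∀ i, ∀ v ∈ W i, amb (ψ (i + 2)) (ρ a v) = ρ a (amb (ψ i) v) := by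
    intro i v hv
    have key : ρ a v = ρ (a * a) (ρ a⁻¹ v) := by
      rw [mul_app]; congr 2; group
    have mA := memA i v hv
    rcases cases4 i with rfl | rfl | rfl | rfl
    · rw [hψ2 _ mA, hψ0 _ hv, mul_app, inv_mul_cancel, one_app]
    · rw [h13] at mA ⊢
      rw [hψ3 _ mA, hψ1 _ hv, mul_app, inv_mul_cancel, one_app]
    · rw [h22] at mA ⊢
      rw [hψ0 _ mA, hψ2 _ hv, key, hp _ sqK _ (memA2 v hv), mul_app]
    · rw [h32] at mA ⊢
      rw [hψ1 _ mA, hψ3 _ hv, key, hq _ sqK _ (memA3 v hv), mul_app]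
  refine ⟨ψ, (isClutch_iff ρ hmem hfree ψ).2 ⟨?_, ?_⟩, hψ0, hψ1⟩
  · have step : ∀ i i', i' = i + 1 → (∀ v ∈ W i,
          amb (ψ (i + 3)) (amb (ψ (i + 2)) (amb (ψ (i + 1)) (amb (ψ i) v))) = v) →
        ∀ v ∈ W i', amb (ψ (i' + 3)) (amb (ψ (i' + 2)) (amb (ψ (i' + 1))
          (amb (ψ i') v))) = v := by
      rintro i _ rfl h v hv
      obtain ⟨u, hu, rfl⟩ := exists_amb_eq (ψ i) hv
      rw [amb_index ψ (show i + 1 + 1 = i + 2 by clear * -; revert i; decide),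
        amb_index ψ (show i + 1 + 2 = i + 3 by clear * -; revert i; decide),
        amb_index ψ (show i + 1 + 3 = i by clear * -; revert i; decide), h u hu]
    have base : ∀ v ∈ W j,
        amb (ψ (j + 3)) (amb (ψ (j + 2)) (amb (ψ (j + 1)) (amb (ψ j) v))) = v := by
      intro v hv
      have m1 := amb_mem p hv
      have m2 := amb_mem q m1
      have m3 := memA2 _ m2
      have m4 := amb_mem p m3
      have m5 : ρ a (amb p (ρ a⁻¹ (amb q (amb p v)))) ∈ W (j + 3) := h13 ▸ memA _ _ m4
      rw [hψ0 _ hv, hψ1 _ m1, hψ2 _ m2, hψ3 _ m5, mul_app a⁻¹ a, inv_mul_cancel, one_app,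
        hpq v hv]
    have s1 := step _ _ rfl base
    have s2 := step _ _ h12.symm s1
    have s3 := step _ (j + 3) (by clear * -; revert j; decide) s2
    intro i
    rcases cases4 i with rfl | rfl | rfl | rfl
    exacts [base, s1, s2, s3]
  · intro g i v hv
    by_cases hg : InKernel (m := 4) N₂ g
    · rw [hg, eqK g hg i v hv]
    · have hn : InKernel (m := 4) N₂ (a⁻¹ * g) := by
        intro k
        rw [mul_smul, hinv, hfree g hg]
        clear * -; revert k; decide
      have hga : ∀ x, ρ g x = ρ a (ρ (a⁻¹ * g) x) := by
        intro x; rw [mul_app, mul_inv_cancel_left]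
      rw [hfree g hg, hga, hga, eqA i _ (memK _ hn i v hv), eqK _ hn i v hv]

end Action

/-- Let `m = 4`, `N₀ ≠ N₂`, and suppose every `g ∉ N₀` acts by
`j ↦ j + 2`; fix `a₀ ∉ N₀`.  Let `j' = j + 2`, `j'' ∉ {j, j'}` and let `k` represent
`j'' - j'`.  Then `ψ ↦ (Ψ_j², Ψ_{j'}^k)` is a bijection from `𝒜` onto `P × Q`, where
`P` consists of the `N₀`-equivariant equivalences `B : W j ≃ W j'` with
`ρ(a₀) ∘ B ∘ ρ(a₀)⁻¹ = B⁻¹` and `Q` consists of the `N₀`-equivariant equivalences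
`C : W j' ≃ W j''`.  (Stated as: the map lands in `P × Q`, is injective, and is
surjective onto `P × Q`.) -/
theorem stmt_12 {N₂ : Type*} [Group N₂] [MulAction N₂ (ZMod 4)]
    {V : Type*} [AddCommGroup V] [Module ℂ V] [FiniteDimensional ℂ V]
    (ρ : N₂ →* (V ≃ₗ[ℂ] V)) (W : ZMod 4 → Submodule ℂ V)
    (hIndep : ∀ j : ZMod 4, Disjoint (W j) (⨆ k : ZMod 4, ⨆ (_ : k ≠ j), W k))
    (hSpan : (⨆ j : ZMod 4, W j) = ⊤)
    (hWρ : ∀ (g : N₂) (j : ZMod 4), (W j).map (ρ g).toLinearMap = W (g • j))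
    (hfib : ∀ j j' : ZMod 4, ∃ e : W j ≃ₗ[ℂ] W j',
      ∀ g : N₂, InKernel (m := 4) N₂ g → IsEquivariantOn ρ e g)
    (hfree : ∀ g : N₂, ¬ InKernel (m := 4) N₂ g → ∀ j : ZMod 4, g • j = j + 2)
    (a₀ : N₂) (ha₀ : ¬ InKernel (m := 4) N₂ a₀)
    (j j' j'' : ZMod 4) (hj' : j' = j + 2) (hj''j : j'' ≠ j) (hj''j' : j'' ≠ j') :
    -- the map `ψ ↦ (Ψ_j², Ψ_{j'}^k)` lands in `P × Q` …
    (∀ ψ : {ψ : ∀ i : ZMod 4, W i ≃ₗ[ℂ] W (i + 1) // IsClutch ρ W ψ},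
      (∀ g : N₂, InKernel (m := 4) N₂ g → IsEquivariantOn ρ (Psi W ψ.1 j 2) g) ∧
      (∀ (u : W j') (w : W j) (u' : W (j + ((2 : ℕ) : ZMod 4))),
        (w : V) = ρ a₀⁻¹ (u : V) → (u' : V) = (u : V) →
        ρ a₀ (((Psi W ψ.1 j 2) w : V)) = (((Psi W ψ.1 j 2).symm u' : V))) ∧
      (∀ g : N₂, InKernel (m := 4) N₂ g →
        IsEquivariantOn ρ (Psi W ψ.1 j' ((j'' - j').val)) g)) ∧
    -- … is injective …
    (∀ ψ φ : {ψ : ∀ i : ZMod 4, W i ≃ₗ[ℂ] W (i + 1) // IsClutch ρ W ψ},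
      (∀ w : W j, ((Psi W ψ.1 j 2) w : V) = ((Psi W φ.1 j 2) w : V)) →
      (∀ u : W j', ((Psi W ψ.1 j' ((j'' - j').val)) u : V) =
        ((Psi W φ.1 j' ((j'' - j').val)) u : V)) →
      ψ = φ) ∧
    -- … and is surjective onto `P × Q`.
    (∀ (B : W j ≃ₗ[ℂ] W j') (C : W j' ≃ₗ[ℂ] W j''),
      (∀ g : N₂, InKernel (m := 4) N₂ g → IsEquivariantOn ρ B g) →
      (∀ (u : W j') (w : W j), (w : V) = ρ a₀⁻¹ (u : V) →
        ρ a₀ ((B w : V)) = ((B.symm u : V))) →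
      (∀ g : N₂, InKernel (m := 4) N₂ g → IsEquivariantOn ρ C g) →
      ∃ ψ : ∀ i : ZMod 4, W i ≃ₗ[ℂ] W (i + 1), IsClutch ρ W ψ ∧
        (∀ w : W j, ((Psi W ψ j 2) w : V) = ((B w : V))) ∧
        (∀ u : W j', ((Psi W ψ j' ((j'' - j').val)) u : V) = ((C u : V)))) := by
  have hmem := map_mem ρ hWρ
  have hiff := isClutch_iff ρ hmem hfree
  have memK : ∀ g, InKernel (m := 4) N₂ g → ∀ i, ∀ v ∈ W i, ρ g v ∈ W i := by
    intro g hg i v hv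
    have := hmem g i v hv
    rwa [hg] at this
  have memA : ∀ i, ∀ v ∈ W i, ρ a₀ v ∈ W (i + 2) :=
    fun i v hv => hfree a₀ ha₀ i ▸ hmem a₀ i v hv
  have hinv : ∀ i : ZMod 4, a₀⁻¹ • i = i + 2 := by
    intro i
    rw [inv_smul_eq_iff, hfree a₀ ha₀]
    clear * -; revert i; decide
  have memA' : ∀ i, ∀ v ∈ W i, ρ a₀⁻¹ v ∈ W (i + 2) :=
    fun i v hv => hinv i ▸ hmem a₀⁻¹ i v hv
  have h12 : j + 1 + 1 = j + 2 := by clear * -; revert j; decide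
  have h22 : j + 2 + 2 = j := by clear * -; revert j; decide
  have h23 : j + 2 + 3 = j + 1 := by clear * -; revert j; decide
  have inv_ρ : ∀ v, ρ a₀ (ρ a₀⁻¹ v) = v := by
    intro v; rw [map_inv]; exact (ρ a₀).apply_symm_apply v
  have mul_app : ∀ (g h : N₂) (v : V), ρ g (ρ h v) = ρ (g * h) v := by
    intro g h v; rw [map_mul]; rfl
  have conjK : ∀ g, InKernel (m := 4) N₂ g → InKernel (m := 4) N₂ (a₀ * g * a₀⁻¹) := by
    intro g hg i
    rw [mul_smul, mul_smul, hg, smul_inv_smul]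
  have hcases : j'' = j + 2 + 1 ∨ j'' = j + 1 := by
    subst hj'
    clear * - hj''j hj''j'
    revert j j''; decide
  subst hj'
  have memA2 : ∀ v ∈ W (j + 2), ρ a₀⁻¹ v ∈ W j := fun v hv => h22 ▸ memA' _ v hv
  have hk1 : (j + 2 + 1 - (j + 2)).val = 1 := by clear * -; revert j; decide
  have hk3 : (j + 1 - (j + 2)).val = 3 := by clear * -; revert j; decide
  have shift : ∀ ψ, IsClutch ρ W ψ → ∀ i, ∀ v ∈ W i,
      amb (ψ (i + 2)) (ρ a₀ v) = ρ a₀ (amb (ψ i) v) := by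
    intro ψ hψ i v hv
    rw [← ((hiff ψ).1 hψ).2 a₀ i v hv, hfree a₀ ha₀]
  have cycle : ∀ ψ, IsClutch ρ W ψ → ∀ u ∈ W (j + 2), amb (ψ (j + 1))
      (amb (ψ (j + 2 + 2)) (amb (ψ (j + 2 + 1)) (amb (ψ (j + 2)) u))) = u := by
    intro ψ hψ u hu
    rw [← amb_index ψ h23]
    exact ((hiff ψ).1 hψ).1 (j + 2) u hu
  refine ⟨?_, ?_, ?_⟩
  · rintro ⟨ψ, hψ⟩
    obtain ⟨h4, he⟩ := (hiff ψ).1 hψ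
    have heK : ∀ g, InKernel (m := 4) N₂ g → ∀ i, ∀ v ∈ W i,
        amb (ψ i) (ρ g v) = ρ g (amb (ψ i) v) := by
      intro g hg i v hv
      rw [← he g i v hv, hg]
    have heA := shift ψ hψ
    refine ⟨fun g hg => ?_, ?_, fun g hg => ?_⟩
    · refine (isEquivariantOn_iff ρ _ (memK g hg j)).2 fun v hv => ?_
      rw [amb_Psi_two W ψ hv, amb_Psi_two W ψ (memK g hg j v hv),
        heK g hg _ _ hv, heK g hg _ _ (amb_mem _ hv)]
    · intro u w u' hw hu'
      have hx := memA _ _ (amb_mem (ψ (j + 1)) (amb_mem (ψ j) w.2))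
      have e1 : j + 1 + 1 + 2 = j := by rw [h12, h22]
      have e2 : j + 1 + 2 = j + 2 + 1 := add_right_comm _ _ _
      rw [e1] at hx
      rw [coe_Psi_two]
      have : (Psi W ψ j 2).symm u' = ⟨_, hx⟩ := by
        rw [LinearEquiv.symm_apply_eq]
        apply Subtype.ext
        rw [coe_Psi_two, hu']
        have huw : (u : V) = ρ a₀ w := by rw [hw, inv_ρ]
        have h := h4 (j + 2) u u.2
        rw [amb_index ψ h22, amb_index ψ h23, amb_index ψ e2.symm, huw, heA _ _ w.2,
          heA _ _ (amb_mem _ w.2)] at h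
        rw [huw]
        exact h.symm
      rw [this]
    · refine (isEquivariantOn_iff ρ _ (memK g hg _)).2 fun v hv => ?_
      have hv' := memK g hg _ v hv
      rcases hcases with rfl | rfl
      · rw [hk1, amb_Psi_one W ψ hv, amb_Psi_one W ψ hv',
          heK g hg _ _ hv]
      · have m1 := amb_mem (ψ (j + 2)) hv
        have m2 := amb_mem (ψ (j + 2 + 1)) m1
        rw [hk3, amb_Psi_three W ψ hv, amb_Psi_three W ψ hv',
          heK g hg _ _ hv, heK g hg _ _ m1, heK g hg _ _ ?_]
        exact (show j + 2 + 1 + 1 = j + 2 + 2 by clear * -; revert j; decide) ▸ m2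
  · rintro ⟨ψ, hψ⟩ ⟨φ, hφ⟩ h2 hk
    have h2' : ∀ v ∈ W j,
        amb (ψ (j + 1)) (amb (ψ j) v) = amb (φ (j + 1)) (amb (φ j) v) := by
      intro v hv
      rw [← coe_Psi_two W ψ j ⟨v, hv⟩, ← coe_Psi_two W φ j ⟨v, hv⟩]
      exact h2 ⟨v, hv⟩
    have agree_shift : ∀ i, (∀ v ∈ W i, amb (ψ i) v = amb (φ i) v) →
        ∀ i', i' = i + 2 → ∀ v ∈ W i', amb (ψ i') v = amb (φ i') v := by
      rintro i h _ rfl v hv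
      have hu : ρ a₀⁻¹ v ∈ W i := by
        have := memA' _ v hv
        rwa [show i + 2 + 2 = i by clear * -; revert i; decide] at this
      rw [← inv_ρ v, shift ψ hψ _ _ hu, shift φ hφ _ _ hu, h _ hu]
    have agree : (∀ v ∈ W j, amb (ψ j) v = amb (φ j) v) ∧
        (∀ v ∈ W (j + 1), amb (ψ (j + 1)) v = amb (φ (j + 1)) v) := by
      rcases hcases with rfl | rfl
      · have hj2 : ∀ v ∈ W (j + 2), amb (ψ (j + 2)) v = amb (φ (j + 2)) v := by
          intro v hv
          have := hk ⟨v, hv⟩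
          rwa [hk1, coe_Psi_one, coe_Psi_one] at this
        have hj := agree_shift _ hj2 j h22.symm
        refine ⟨hj, fun v hv => ?_⟩
        obtain ⟨u, hu, rfl⟩ := exists_amb_eq (ψ j) hv
        rw [h2' u hu, hj u hu]
      · have hj1 : ∀ v ∈ W (j + 1), amb (ψ (j + 1)) v = amb (φ (j + 1)) v := by
          intro v hv
          obtain ⟨⟨u, hu⟩, h⟩ := (Psi W ψ (j + 2) 3).surjective
            ⟨v, by rwa [show j + 2 + ((3 : ℕ) : ZMod 4) = j + 1 from h23]⟩
          have hv' := congrArg Subtype.val h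
          have := hk ⟨u, hu⟩
          rw [hk3, coe_Psi_three, coe_Psi_three] at this
          rw [coe_Psi_three] at hv'
          change _ = v at hv'
          rw [← hv', cycle ψ hψ u hu, this, cycle φ hφ u hu]
        refine ⟨fun v hv => amb_injOn (ψ (j + 1)) (amb_mem _ hv) (amb_mem _ hv) ?_, hj1⟩
        rw [h2' v hv, hj1 _ (amb_mem _ hv)]
    apply Subtype.ext
    funext i
    apply LinearEquiv.ext
    intro w
    apply Subtype.ext
    change (ψ i w : V) = φ i w
    rw [← amb_coe, ← amb_coe]
    have cases4 : i = j ∨ i = j + 1 ∨ i = j + 2 ∨ i = j + 1 + 2 := by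
      clear * -; revert i j; decide
    rcases cases4 with rfl | rfl | rfl | rfl
    · exact agree.1 _ w.2
    · exact agree.2 _ w.2
    · exact agree_shift _ agree.1 _ rfl _ w.2
    · exact agree_shift _ agree.2 _ rfl _ w.2
  · intro B C hB hBa hC
    have hB' := fun g hg => (isEquivariantOn_iff ρ B (memK g hg j)).1 (hB g hg)
    have hC' := fun g hg => (isEquivariantOn_iff ρ C (memK g hg (j + 2))).1 (hC g hg)
    have hBB : ∀ v ∈ W j, ρ a₀ (amb B (ρ a₀⁻¹ (amb B v))) = v := by
      intro v hv
      have h := hBa (B ⟨v, hv⟩) ⟨ρ a₀⁻¹ (B ⟨v, hv⟩), memA2 _ (B ⟨v, hv⟩).2⟩ rfl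
      rw [LinearEquiv.symm_apply_apply, ← amb_coe] at h
      rw [show amb B v = B ⟨v, hv⟩ from amb_coe B ⟨v, hv⟩]
      exact h
    rcases hcases with rfl | rfl
    · obtain ⟨p, hp⟩ := exists_amb_eq_conj ρ hWρ a₀⁻¹ ((hinv (j + 2)).trans h22)
        (show a₀⁻¹ • (j + 2 + 1) = j + 1 by
          rw [hinv]; clear * -; revert j; decide) C
      simp only [inv_inv] at hp
      have hpK : ∀ g, InKernel (m := 4) N₂ g → ∀ v ∈ W j, amb p (ρ g v) = ρ g (amb p v) := by
        intro g hg v hv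
        have key : ρ a₀ (ρ g v) = ρ (a₀ * g * a₀⁻¹) (ρ a₀ v) := by
          simp only [mul_app]; congr 2; group
        rw [hp _ (memK g hg _ _ hv), hp _ hv, key, hC' _ (conjK g hg) _ (memA _ _ hv)]
        simp only [mul_app]; congr 2; group
      have hqp : ∀ v ∈ W j, amb (p.symm.trans B) (amb p v) = amb B v := by
        intro v hv
        rw [amb_trans _ _ (amb_mem p hv), amb_symm_amb p hv]
      obtain ⟨ψ, hψ, h0, h1⟩ := exists_isClutch ρ hWρ hfree ha₀ j p (p.symm.trans B) hpK
        (fun g hg v hv => by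
          rw [amb_trans _ _ hv, amb_trans _ _ (memK g hg _ _ hv),
            amb_symm_commute p (memK g hg j) (hpK g hg) hv,
            hB' g hg _ (amb_mem p.symm hv)])
        (fun v hv => by
          rw [hqp v hv, hqp _ (memA2 _ (amb_mem B hv)), hBB v hv])
      refine ⟨ψ, hψ, fun w => ?_, fun u => ?_⟩
      · rw [coe_Psi_two, h0 _ w.2, h1 _ (amb_mem p w.2), hqp _ w.2, amb_coe]
      · have hu := memA2 _ u.2
        rw [hk1, coe_Psi_one, ← inv_ρ (u : V), shift ψ hψ j _ hu, h0 _ hu, hp _ hu, inv_ρ, inv_ρ,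
          amb_coe]
    · have hqp : ∀ v ∈ W j, amb C.symm (amb (B.trans C) v) = amb B v := by
        intro v hv
        rw [amb_trans _ _ hv, amb_symm_amb C (amb_mem B hv)]
      obtain ⟨ψ, hψ, h0, h1⟩ := exists_isClutch ρ hWρ hfree ha₀ j (B.trans C) C.symm
        (fun g hg v hv => by
          rw [amb_trans _ _ hv, amb_trans _ _ (memK g hg _ _ hv), hB' g hg v hv,
            hC' g hg _ (amb_mem B hv)])
        (fun g hg v hv => amb_symm_commute C (memK g hg (j + 2)) (hC' g hg) hv)
        (fun v hv => by
          rw [hqp v hv, hqp _ (memA2 _ (amb_mem B hv)), hBB v hv])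
      refine ⟨ψ, hψ, fun w => ?_, fun u => ?_⟩
      · rw [coe_Psi_two, h0 _ w.2, h1 _ (amb_mem _ w.2), hqp _ w.2, amb_coe]
      · have hx : ((Psi W ψ (j + 2) 3 u : W _) : V) ∈ W (j + 1) := by
          rw [← h23]
          exact (Psi W ψ (j + 2) 3 u).2
        have hcyc := cycle ψ hψ u u.2
        rw [← coe_Psi_three, h1 _ hx] at hcyc
        rw [hk3, ← amb_coe C, ← hcyc, amb_amb_symm C hx]

end EqClutch
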